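/- For every initial datum V⁰ ∈ ℓ²(ℤ;ℂ), there exists T > 0 such that the Cauchy problem for the modified discrete nonlinear Schrödinger equation has a solution V : [0,T] → ℓ²(ℤ;ℂ) with V(0) = V⁰ that is continuously differentiable as a map into ℓ²(ℤ;ℂ), and this solution is unique: any two continuously differentiable ℓ²-valued solutions on [0,T] with the same initial datum V⁰ coincide. -/

import Mathlib

noncomputable section

/-- The space `ℓ²(ℤ;ℂ)` of square-summable complex sequences. -/
abbrev l2Z : Type := lp (fun _ : ℤ => ℂ) 2

/-- Discrete Laplacian `(Δ_d u)_n = u_{n+1} - 2 u_n + u_{n-1}`. -/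
def discLap (u : ℤ → ℂ) (n : ℤ) : ℂ := u (n + 1) - 2 * u n + u (n - 1)

/-- The step background: `q_n = q_-` for `n ≤ 0` and `q_n = q_+` for `n ≥ 1`. -/
def stepBg (qm qp : ℂ) (n : ℤ) : ℂ := if n ≤ 0 then qm else qp

/-- The ℓ² norm `(Σ_{n ∈ ℤ} |f n|²)^{1/2}` of a complex sequence. -/
def l2norm (f : ℤ → ℂ) : ℝ := Real.sqrt (∑' n : ℤ, ‖f n‖ ^ 2)

/-- Ablowitz–Ladik nonlinearity
`F_AL(U)_n = -2q²(U_n+q_n) + |U_n+q_n|²(U_{n+1}+U_{n-1}+q_{n+1}+q_{n-1})`. -/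
def F_AL (q : ℝ) (qm qp : ℂ) (U : ℤ → ℂ) (n : ℤ) : ℂ :=
  -(2 * (q : ℂ) ^ 2) * (U n + stepBg qm qp n)
    + (‖U n + stepBg qm qp n‖ : ℂ) ^ 2
      * (U (n + 1) + U (n - 1) + stepBg qm qp (n + 1) + stepBg qm qp (n - 1))

/-- DNLS nonlinearity `F_DNLS(V)_n = 2(|V_n+q_n|² - q²)(V_n+q_n)`. -/
def F_DNLS (q : ℝ) (qm qp : ℂ) (V : ℤ → ℂ) (n : ℤ) : ℂ :=
  2 * ((‖V n + stepBg qm qp n‖ : ℂ) ^ 2 - (q : ℂ) ^ 2) * (V n + stepBg qm qp n)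

/-- `U` is a continuously differentiable `ℓ²`-valued solution of the modified
Ablowitz–Ladik equation `i U̇_n + κ(Δ_d U)_n + κ(Δ_d q)_n + F_AL(U)_n = 0` on `[0,T]`. -/
def IsModALSol (κ q : ℝ) (qm qp : ℂ) (T : ℝ) (U : ℝ → l2Z) : Prop :=
  ∃ U' : ℝ → l2Z,
    ContinuousOn U' (Set.Icc 0 T) ∧
    (∀ t ∈ Set.Icc (0:ℝ) T, HasDerivWithinAt U (U' t) (Set.Icc 0 T) t) ∧
    (∀ t ∈ Set.Icc (0:ℝ) T, ∀ n : ℤ,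
      Complex.I * U' t n + (κ : ℂ) * discLap (⇑(U t)) n
        + (κ : ℂ) * discLap (stepBg qm qp) n + F_AL q qm qp (⇑(U t)) n = 0)

/-- `V` is a continuously differentiable `ℓ²`-valued solution of the modified
DNLS equation `i V̇_n + κ(Δ_d V)_n + κ(Δ_d q)_n + F_DNLS(V)_n = 0` on `[0,T]`. -/
def IsModDNLSSol (κ q : ℝ) (qm qp : ℂ) (T : ℝ) (V : ℝ → l2Z) : Prop :=
  ∃ V' : ℝ → l2Z,
    ContinuousOn V' (Set.Icc 0 T) ∧
    (∀ t ∈ Set.Icc (0:ℝ) T, HasDerivWithinAt V (V' t) (Set.Icc 0 T) t) ∧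
    (∀ t ∈ Set.Icc (0:ℝ) T, ∀ n : ℤ,
      Complex.I * V' t n + (κ : ℂ) * discLap (⇑(V t)) n
        + (κ : ℂ) * discLap (stepBg qm qp) n + F_DNLS q qm qp (⇑(V t)) n = 0)

open Set Metric
open scoped NNReal ENNReal

/-! ### Local well-posedness for vector fields that are Lipschitz on bounded sets -/

section LocallyLipschitzODE

variable {E : Type*} [NormedAddCommGroup E] [NormedSpace ℝ E] {Φ : E → E}

/-- An autonomous vector field that is Lipschitz near `x₀` has a forward integral curve from `x₀`. -/
theorem exists_hasDerivWithinAt_Icc_of_lipschitzOnWith [CompleteSpace E] {x₀ : E} {K : ℝ≥0}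
    (hΦ : LipschitzOnWith K Φ (closedBall x₀ 1)) :
    ∃ T : ℝ, 0 < T ∧ ∃ V : ℝ → E, V 0 = x₀ ∧
      ∀ t ∈ Icc (0 : ℝ) T, HasDerivWithinAt V (Φ (V t)) (Icc 0 T) t := by
  set L : ℝ≥0 := K + ‖Φ x₀‖₊ + 1
  have hL : (0 : ℝ) < L := by positivity
  have hT : (0 : ℝ) < (L : ℝ)⁻¹ := inv_pos.2 hL
  have hbound : ∀ x ∈ closedBall x₀ ((1 : ℝ≥0) : ℝ), ‖Φ x‖ ≤ L := by
    intro x hx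
    have hlip := hΦ.norm_sub_le hx (mem_closedBall_self zero_le_one)
    have hdist : ‖x - x₀‖ ≤ 1 := by simpa [dist_eq_norm] using hx
    have hmul : (K : ℝ) * ‖x - x₀‖ ≤ K := mul_le_of_le_one_right K.coe_nonneg hdist
    have htri := norm_sub_norm_le (Φ x) (Φ x₀)
    simp only [L, NNReal.coe_add, coe_nnnorm, NNReal.coe_one]
    linarith
  have hpl : IsPicardLindelof (fun _ : ℝ => Φ) (tmin := 0) (tmax := (L : ℝ)⁻¹)
      ⟨0, left_mem_Icc.2 hT.le⟩ x₀ 1 0 L K := by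
    refine IsPicardLindelof.of_time_independent hbound hΦ ?_
    simp [hL.ne']
  obtain ⟨V, hV0, hV⟩ := hpl.exists_eq_forall_mem_Icc_hasDerivWithinAt₀
  exact ⟨_, hT, V, hV0, hV⟩

/-- Forward integral curves of a vector field that is Lipschitz on bounded sets are determined by
their initial value. -/
theorem eqOn_Icc_of_lipschitzOnWith_closedBall
    (hΦ : ∀ R : ℝ, ∃ K : ℝ≥0, LipschitzOnWith K Φ (closedBall 0 R)) {T : ℝ} {V W : ℝ → E}
    (hV : ∀ t ∈ Icc (0 : ℝ) T, HasDerivWithinAt V (Φ (V t)) (Icc 0 T) t)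
    (hW : ∀ t ∈ Icc (0 : ℝ) T, HasDerivWithinAt W (Φ (W t)) (Icc 0 T) t)
    (h0 : V 0 = W 0) : EqOn V W (Icc 0 T) := by
  have hVc : ContinuousOn V (Icc 0 T) := fun t ht => (hV t ht).continuousWithinAt
  have hWc : ContinuousOn W (Icc 0 T) := fun t ht => (hW t ht).continuousWithinAt
  obtain ⟨A, hA⟩ := isCompact_Icc.exists_bound_of_continuousOn hVc
  obtain ⟨B, hB⟩ := isCompact_Icc.exists_bound_of_continuousOn hWc
  obtain ⟨K, hK⟩ := hΦ (max A B)
  have hnhds : ∀ t ∈ Ico (0 : ℝ) T, Icc 0 T ∈ nhdsWithin t (Ici t) := fun t ht =>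
    Filter.mem_of_superset (Icc_mem_nhdsGE ht.2) (Icc_subset_Icc_left ht.1)
  refine ODE_solution_unique_of_mem_Icc_right (v := fun _ => Φ) (s := fun _ => closedBall 0 (max A B))
    (fun _ _ => hK) hVc (fun t ht => ?_) (fun t ht => ?_) hWc (fun t ht => ?_) (fun t ht => ?_) h0
  · exact (hV t (Ico_subset_Icc_self ht)).mono_of_mem_nhdsWithin (hnhds t ht)
  · simpa using Or.inl (hA t (Ico_subset_Icc_self ht))
  · exact (hW t (Ico_subset_Icc_self ht)).mono_of_mem_nhdsWithin (hnhds t ht)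
  · simpa using Or.inr (hB t (Ico_subset_Icc_self ht))

end LocallyLipschitzODE

/-! ### Sequences dominated by neighbouring values of an `ℓ²` sequence -/

theorem Memℓp.comp_equiv {ι : Type*} {F : Type*} [NormedAddCommGroup F] {p : ℝ≥0∞}
    (hp : 0 < p.toReal) {f : ι → F} (hf : Memℓp f p) (e : ι ≃ ι) : Memℓp (fun i => f (e i)) p :=
  memℓp_gen ((e.summable_iff (f := fun i => ‖f i‖ ^ p.toReal)).2 (hf.summable hp))

theorem lp.norm_comp_equiv {ι : Type*} {F : Type*} [NormedAddCommGroup F] {p : ℝ≥0∞}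
    (hp : 0 < p.toReal) {f g : lp (fun _ : ι => F) p} (e : ι ≃ ι) (hg : ∀ i, g i = f (e i)) :
    ‖g‖ = ‖f‖ := by
  rw [lp.norm_eq_tsum_rpow hp, lp.norm_eq_tsum_rpow hp]
  simp only [hg]
  rw [e.tsum_eq (fun i => ‖f i‖ ^ p.toReal)]

/-- The sequence `C (|f (n+1)| + |f n| + |f (n-1)|)` is in `ℓ²`, with norm at most `3 C ‖f‖`. -/
theorem exists_lp_neighbour_majorant (f : l2Z) {C : ℝ} (hC : 0 ≤ C) :
    ∃ h : lp (fun _ : ℤ => ℝ) 2,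
      (∀ n, h n = C * (‖f (n + 1)‖ + ‖f n‖ + ‖f (n - 1)‖)) ∧ ‖h‖ ≤ 3 * C * ‖f‖ := by
  have hp : 0 < (2 : ℝ≥0∞).toReal := by norm_num
  let g : lp (fun _ : ℤ => ℝ) 2 := lp.toNorm f
  have hg : ‖g‖ = ‖f‖ := lp.norm_toNorm
  let gr : lp (fun _ : ℤ => ℝ) 2 := ⟨_, (lp.memℓp g).comp_equiv hp (Equiv.addRight 1)⟩
  let gl : lp (fun _ : ℤ => ℝ) 2 := ⟨_, (lp.memℓp g).comp_equiv hp (Equiv.subRight 1)⟩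
  have hgr : ‖gr‖ = ‖f‖ := (lp.norm_comp_equiv hp (Equiv.addRight 1) fun _ => rfl).trans hg
  have hgl : ‖gl‖ = ‖f‖ := (lp.norm_comp_equiv hp (Equiv.subRight 1) fun _ => rfl).trans hg
  refine ⟨C • (gr + g + gl), fun n => rfl, ?_⟩
  rw [norm_smul, Real.norm_of_nonneg hC]
  have := norm_add₃_le (a := gr) (b := g) (c := gl)
  nlinarith

theorem memℓp_of_le_neighbours {C : ℝ} (hC : 0 ≤ C) (f : l2Z) {g : ℤ → ℂ}
    (hg : ∀ n, ‖g n‖ ≤ C * (‖f (n + 1)‖ + ‖f n‖ + ‖f (n - 1)‖)) : Memℓp g 2 := by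
  obtain ⟨h, hh, -⟩ := exists_lp_neighbour_majorant f hC
  exact (lp.memℓp h).mono fun n => (hg n).trans_eq (hh n).symm

theorem norm_le_of_le_neighbours {C : ℝ} (hC : 0 ≤ C) (f g : l2Z)
    (hg : ∀ n, ‖g n‖ ≤ C * (‖f (n + 1)‖ + ‖f n‖ + ‖f (n - 1)‖)) : ‖g‖ ≤ 3 * C * ‖f‖ := by
  obtain ⟨h, hh, hle⟩ := exists_lp_neighbour_majorant f hC
  refine (lp.norm_mono two_ne_zero fun n => ?_).trans hle
  rw [hh n]
  exact (hg n).trans (le_abs_self _)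

/-! ### The vector field of the modified DNLS equation -/

/-- The right-hand side of the equation solved for the time derivative,
`V̇_n = i (κ (Δ_d V)_n + κ (Δ_d q)_n + F_DNLS(V)_n)`. -/
def dnlsRhs (κ q : ℝ) (qm qp : ℂ) (u : ℤ → ℂ) (n : ℤ) : ℂ :=
  Complex.I * ((κ : ℂ) * discLap u n + (κ : ℂ) * discLap (stepBg qm qp) n + F_DNLS q qm qp u n)

theorem norm_stepBg {q : ℝ} {qm qp : ℂ} (hqm : ‖qm‖ = q) (hqp : ‖qp‖ = q) (n : ℤ) :
    ‖stepBg qm qp n‖ = q := by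
  unfold stepBg
  split_ifs <;> assumption

theorem norm_cubic_sub_le {M q : ℝ} {a b : ℂ} (ha : ‖a‖ ≤ M) (hb : ‖b‖ ≤ M) :
    ‖2 * ((‖a‖ : ℂ) ^ 2 - (q : ℂ) ^ 2) * a - 2 * ((‖b‖ : ℂ) ^ 2 - (q : ℂ) ^ 2) * b‖
      ≤ (6 * M ^ 2 + 2 * q ^ 2) * ‖a - b‖ := by
  have hsplit : 2 * ((‖a‖ : ℂ) ^ 2 - (q : ℂ) ^ 2) * a - 2 * ((‖b‖ : ℂ) ^ 2 - (q : ℂ) ^ 2) * b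
      = ((2 * (‖a‖ ^ 2 - q ^ 2) : ℝ) : ℂ) * (a - b)
        + ((2 * ((‖a‖ - ‖b‖) * (‖a‖ + ‖b‖)) : ℝ) : ℂ) * b := by
    push_cast
    ring
  have ha0 := norm_nonneg a
  have hb0 := norm_nonneg b
  have hd0 := norm_nonneg (a - b)
  have hM : 0 ≤ M := ha0.trans ha
  have h1 : |2 * (‖a‖ ^ 2 - q ^ 2)| ≤ 2 * M ^ 2 + 2 * q ^ 2 := by
    rw [abs_le]
    constructor <;> nlinarith [sq_nonneg q]
  have h2 : |2 * ((‖a‖ - ‖b‖) * (‖a‖ + ‖b‖))| ≤ 4 * M * ‖a - b‖ := by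
    rw [abs_mul, abs_mul, abs_two, abs_of_nonneg (add_nonneg ha0 hb0)]
    have := mul_le_mul (abs_norm_sub_norm_le a b) (add_le_add ha hb) (add_nonneg ha0 hb0) hd0
    linarith
  calc _ ≤ |2 * (‖a‖ ^ 2 - q ^ 2)| * ‖a - b‖
        + |2 * ((‖a‖ - ‖b‖) * (‖a‖ + ‖b‖))| * ‖b‖ := by
        rw [hsplit]
        refine (norm_add_le _ _).trans_eq ?_
        rw [norm_mul, norm_mul, Complex.norm_real, Complex.norm_real, Real.norm_eq_abs,
          Real.norm_eq_abs]
    _ ≤ (2 * M ^ 2 + 2 * q ^ 2) * ‖a - b‖ + (4 * M * ‖a - b‖) * M := by gcongr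
    _ = _ := by ring

section VectorField

variable {κ q : ℝ} {qm qp : ℂ}

/-- Pointwise Lipschitz estimate for the vector field on bounded sequences. -/
theorem norm_dnlsRhs_sub_le (hqm : ‖qm‖ = q) (hqp : ‖qp‖ = q) {R : ℝ} {u w : ℤ → ℂ}
    (hu : ∀ n, ‖u n‖ ≤ R) (hw : ∀ n, ‖w n‖ ≤ R) (n : ℤ) :
    ‖dnlsRhs κ q qm qp u n - dnlsRhs κ q qm qp w n‖
      ≤ (2 * |κ| + (6 * (R + q) ^ 2 + 2 * q ^ 2))
        * (‖u (n + 1) - w (n + 1)‖ + ‖u n - w n‖ + ‖u (n - 1) - w (n - 1)‖) := by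
  have hbg : ∀ v : ℤ → ℂ, (∀ n, ‖v n‖ ≤ R) → ‖v n + stepBg qm qp n‖ ≤ R + q := fun v hv =>
    (norm_add_le _ _).trans (add_le_add (hv n) (norm_stepBg hqm hqp n).le)
  have hcubic := norm_cubic_sub_le (q := q) (hbg u hu) (hbg w hw)
  rw [add_sub_add_right_eq_sub] at hcubic
  have hsplit : dnlsRhs κ q qm qp u n - dnlsRhs κ q qm qp w n
      = Complex.I * ((κ : ℂ) * ((u (n + 1) - w (n + 1)) - 2 * (u n - w n)
          + (u (n - 1) - w (n - 1))) + (F_DNLS q qm qp u n - F_DNLS q qm qp w n)) := by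
    unfold dnlsRhs discLap
    ring
  have hlap : ‖(u (n + 1) - w (n + 1)) - 2 * (u n - w n) + (u (n - 1) - w (n - 1))‖
      ≤ ‖u (n + 1) - w (n + 1)‖ + 2 * ‖u n - w n‖ + ‖u (n - 1) - w (n - 1)‖ := by
    refine (norm_add_le _ _).trans (add_le_add_left ((norm_sub_le _ _).trans_eq ?_) _)
    simp
  have hx := norm_nonneg (u (n + 1) - w (n + 1))
  have hy := norm_nonneg (u n - w n)
  have hz := norm_nonneg (u (n - 1) - w (n - 1))
  rw [hsplit, norm_mul, Complex.norm_I, one_mul]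
  calc _ ≤ |κ| * (‖u (n + 1) - w (n + 1)‖ + 2 * ‖u n - w n‖ + ‖u (n - 1) - w (n - 1)‖)
        + (6 * (R + q) ^ 2 + 2 * q ^ 2) * ‖u n - w n‖ := by
        refine (norm_add_le _ _).trans (add_le_add ?_ hcubic)
        rw [norm_mul, Complex.norm_real, Real.norm_eq_abs]
        gcongr
    _ ≤ |κ| * (2 * (‖u (n + 1) - w (n + 1)‖ + ‖u n - w n‖ + ‖u (n - 1) - w (n - 1)‖))
        + (6 * (R + q) ^ 2 + 2 * q ^ 2)
          * (‖u (n + 1) - w (n + 1)‖ + ‖u n - w n‖ + ‖u (n - 1) - w (n - 1)‖) := by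
        gcongr <;> linarith
    _ = _ := by ring

/-- At the zero sequence the vector field is supported on `{0, 1}`, hence square-summable. -/
theorem memℓp_dnlsRhs_zero (hqm : ‖qm‖ = q) (hqp : ‖qp‖ = q) :
    Memℓp (dnlsRhs κ q qm qp 0) 2 := by
  refine Memℓp.of_exponent_ge (memℓp_zero ?_) (zero_le (a := (2 : ℝ≥0∞)))
  refine (Set.finite_Icc (0 : ℤ) 1).subset fun n hn => ?_
  by_contra hmem
  refine hn ?_
  have hlap : discLap (stepBg qm qp) n = 0 := by
    rw [mem_Icc, not_and_or, not_le, not_le] at hmem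
    unfold discLap stepBg
    rcases hmem with h | h
    · rw [if_pos (by omega), if_pos (by omega), if_pos (by omega)]
      ring
    · rw [if_neg (by omega), if_neg (by omega), if_neg (by omega)]
      ring
  have hF : F_DNLS q qm qp 0 n = 0 := by simp [F_DNLS, norm_stepBg hqm hqp]
  rw [dnlsRhs, hlap, hF]
  simp [discLap]

theorem memℓp_dnlsRhs (hqm : ‖qm‖ = q) (hqp : ‖qp‖ = q) (u : l2Z) :
    Memℓp (dnlsRhs κ q qm qp u) 2 := by
  have hq : 0 ≤ q := hqm ▸ norm_nonneg qm
  have hdiff : Memℓp (dnlsRhs κ q qm qp u - dnlsRhs κ q qm qp 0) 2 := by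
    refine memℓp_of_le_neighbours (C := 2 * |κ| + (6 * (‖u‖ + q) ^ 2 + 2 * q ^ 2))
      (by positivity) u fun n => ?_
    have h := norm_dnlsRhs_sub_le (κ := κ) hqm hqp (lp.norm_apply_le_norm two_ne_zero u)
      (w := fun _ => 0) (fun _ => norm_zero.trans_le (norm_nonneg u)) n
    simp only [sub_zero] at h
    exact h
  have hsum := hdiff.add (memℓp_dnlsRhs_zero (κ := κ) hqm hqp)
  rwa [sub_add_cancel] at hsum

/-- The vector field of the modified DNLS equation as a map of `ℓ²(ℤ;ℂ)`. -/
def dnlsField (κ : ℝ) (hqm : ‖qm‖ = q) (hqp : ‖qp‖ = q) (u : l2Z) : l2Z :=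
  ⟨dnlsRhs κ q qm qp u, memℓp_dnlsRhs hqm hqp u⟩

theorem exists_lipschitzOnWith_dnlsField (hqm : ‖qm‖ = q) (hqp : ‖qp‖ = q) (R : ℝ) :
    ∃ K : ℝ≥0, LipschitzOnWith K (dnlsField κ hqm hqp) (closedBall 0 R) := by
  set C : ℝ := 2 * |κ| + (6 * (R + q) ^ 2 + 2 * q ^ 2)
  have hC : 0 ≤ C := by positivity
  refine ⟨⟨3 * C, by positivity⟩, LipschitzOnWith.of_dist_le_mul fun u hu w hw => ?_⟩
  rw [mem_closedBall_zero_iff] at hu hw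
  rw [dist_eq_norm, dist_eq_norm]
  exact norm_le_of_le_neighbours hC (u - w) _ fun n => norm_dnlsRhs_sub_le hqm hqp
    (fun n => (lp.norm_apply_le_norm two_ne_zero u n).trans hu)
    (fun n => (lp.norm_apply_le_norm two_ne_zero w n).trans hw) n

/-- Solutions of the modified DNLS equation are the integral curves of `dnlsField`. -/
theorem isModDNLSSol_iff (hqm : ‖qm‖ = q) (hqp : ‖qp‖ = q) {T : ℝ} {V : ℝ → l2Z} :
    IsModDNLSSol κ q qm qp T V ↔
      ∀ t ∈ Icc (0 : ℝ) T, HasDerivWithinAt V (dnlsField κ hqm hqp (V t)) (Icc 0 T) t := by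
  constructor
  · rintro ⟨V', -, hV, heq⟩ t ht
    convert hV t ht using 1
    refine lp.ext (funext fun n => ?_)
    change dnlsRhs κ q qm qp (V t) n = V' t n
    unfold dnlsRhs
    linear_combination Complex.I * heq t ht n - V' t n * Complex.I_mul_I
  · intro hV
    have hVc : ContinuousOn V (Icc 0 T) := fun t ht => (hV t ht).continuousWithinAt
    refine ⟨fun t => dnlsField κ hqm hqp (V t), ?_, hV, fun t _ n => ?_⟩
    · obtain ⟨A, hA⟩ := isCompact_Icc.exists_bound_of_continuousOn hVc
      obtain ⟨K, hK⟩ := exists_lipschitzOnWith_dnlsField (κ := κ) hqm hqp A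
      exact hK.continuousOn.comp hVc fun t ht => by simpa using hA t ht
    · change Complex.I * dnlsRhs κ q qm qp (V t) n + _ + _ + _ = 0
      unfold dnlsRhs
      linear_combination ((κ : ℂ) * discLap (V t) n + (κ : ℂ) * discLap (stepBg qm qp) n
        + F_DNLS q qm qp (V t) n) * Complex.I_mul_I

end VectorField

/-- local existence and uniqueness for the Cauchy problem of the
modified discrete nonlinear Schrödinger equation in `ℓ²(ℤ;ℂ)`. -/
theorem modDNLS_local_wellposedness
    (κ q : ℝ) (hκ : 0 < κ) (hq : 0 < q) (qm qp : ℂ) (hqm : ‖qm‖ = q) (hqp : ‖qp‖ = q)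
    (V0 : l2Z) :
    ∃ T : ℝ, 0 < T ∧
      (∃ V : ℝ → l2Z, IsModDNLSSol κ q qm qp T V ∧ V 0 = V0) ∧
      (∀ V₁ V₂ : ℝ → l2Z,
        IsModDNLSSol κ q qm qp T V₁ → IsModDNLSSol κ q qm qp T V₂ →
        V₁ 0 = V0 → V₂ 0 = V0 →
        ∀ t ∈ Set.Icc (0:ℝ) T, V₁ t = V₂ t) := by
  obtain ⟨K, hK⟩ := exists_lipschitzOnWith_dnlsField (κ := κ) hqm hqp (‖V0‖ + 1)
  obtain ⟨T, hT, V, hV0, hV⟩ := exists_hasDerivWithinAt_Icc_of_lipschitzOnWith (x₀ := V0)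
    (hK.mono (closedBall_subset_closedBall' (by simp [add_comm])))
  refine ⟨T, hT, ⟨V, (isModDNLSSol_iff hqm hqp).2 hV, hV0⟩, fun V₁ V₂ h₁ h₂ h₁0 h₂0 => ?_⟩
  exact eqOn_Icc_of_lipschitzOnWith_closedBall (exists_lipschitzOnWith_dnlsField hqm hqp)
    ((isModDNLSSol_iff hqm hqp).1 h₁) ((isModDNLSSol_iff hqm hqp).1 h₂) (h₁0.trans h₂0.symm)
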